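/- Let P and Q be two polytopes in ℝⁿ such that the normal fan of P refines the normal fan of Q. Then the fundamental hyperplane arrangements satisfy H_Q ⊆ H_P; consequently, if (P,v) is positively oriented then so is (Q,v). -/

import Mathlib

open scoped BigOperators

noncomputable section

/-- Vectors in `ℝⁿ`. -/
abbrev Vec (n : ℕ) := Fin n → ℝ

/-- The standard scalar product on `ℝⁿ`. -/
def dot {n : ℕ} (x y : Vec n) : ℝ := ∑ i, x i * y i

/-- A polytope is the convex hull of a finite set of points. -/
def IsPolytope {n : ℕ} (P : Set (Vec n)) : Prop :=
  ∃ S : Finset (Vec n), P = convexHull ℝ (S : Set (Vec n))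

/-- A face of `P`: either `P` itself (take `c = 0`) or the subset of `P` where some linear
functional attains its maximum over `P`. -/
def IsFace {n : ℕ} (P F : Set (Vec n)) : Prop :=
  ∃ c : Vec n, F = {x ∈ P | ∀ y ∈ P, dot c y ≤ dot c x}

/-- Dimension of a subset of `ℝⁿ`: the rank of the direction of its affine span. -/
noncomputable def sdim {n : ℕ} (A : Set (Vec n)) : ℕ :=
  Module.finrank ℝ (affineSpan ℝ A).direction

/-- The normal cone of a face `F` of `P`. -/
def normalCone {n : ℕ} (P F : Set (Vec n)) : Set (Vec n) :=
  {c | F ⊆ {x ∈ P | ∀ y ∈ P, dot c y ≤ dot c x}}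

/-- `coneOf X`: nonnegative linear combinations of finitely many elements of `X`. -/
def coneOf {n : ℕ} (X : Set (Vec n)) : Set (Vec n) :=
  {v | ∃ (k : ℕ) (x : Fin k → Vec n) (l : Fin k → ℝ),
      (∀ i, x i ∈ X) ∧ (∀ i, 0 ≤ l i) ∧ v = ∑ i, l i • x i}

/-- The reflection `ρ_z P = 2z - P` of `P` with respect to `z`. -/
def reflP {n : ℕ} (z : Vec n) (P : Set (Vec n)) : Set (Vec n) :=
  (fun x => (2 : ℝ) • z - x) '' P

/-- An edge is a 1-dimensional face. -/
def IsEdge {n : ℕ} (P E : Set (Vec n)) : Prop := IsFace P E ∧ sdim E = 1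

/-- `(P, v)` is oriented if `v` is not perpendicular to any edge of `P`. -/
def Oriented {n : ℕ} (P : Set (Vec n)) (v : Vec n) : Prop :=
  ∀ E, IsEdge P E → ∀ d ∈ (affineSpan ℝ E).direction, d ≠ 0 → dot d v ≠ 0

/-- `(P, v)` is positively oriented if `(P ∩ ρ_z P, v)` is oriented for every `z ∈ P`. -/
def PosOriented {n : ℕ} (P : Set (Vec n)) (v : Vec n) : Prop :=
  ∀ z ∈ P, Oriented (P ∩ reflP z P) v

/-- `x` is the minimizer of `⟨-, v⟩` on `P`. -/
def IsBotOf {n : ℕ} (P : Set (Vec n)) (v x : Vec n) : Prop :=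
  x ∈ P ∧ ∀ y ∈ P, dot v x ≤ dot v y

/-- `x` is the maximizer of `⟨-, v⟩` on `P`. -/
def IsTopOf {n : ℕ} (P : Set (Vec n)) (v x : Vec n) : Prop :=
  x ∈ P ∧ ∀ y ∈ P, dot v y ≤ dot v x

/-- `(P, v)` is quasi-oriented if `⟨-, v⟩` has a unique minimizer and a unique maximizer on `P`. -/
def QuasiOriented {n : ℕ} (P : Set (Vec n)) (v : Vec n) : Prop :=
  (∃! x, IsBotOf P v x) ∧ (∃! x, IsTopOf P v x)

/-- `(P, v)` is quasi-positively oriented if `(P ∩ ρ_z P, v)` is quasi-oriented for all `z ∈ P`. -/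
def QuasiPosOriented {n : ℕ} (P : Set (Vec n)) (v : Vec n) : Prop :=
  ∀ z ∈ P, QuasiOriented (P ∩ reflP z P) v

/-- The polytope `P^φ = π^φ(P × P) ⊆ ℝ^{n+1}`, where `π^φ(x,y) = ((x+y)/2, ⟨x - y, v⟩)`. -/
def Pphi {n : ℕ} (P : Set (Vec n)) (v : Vec n) : Set (Vec (n + 1)) :=
  {w | ∃ x ∈ P, ∃ y ∈ P, w = Fin.snoc ((1 / 2 : ℝ) • (x + y)) (dot (x - y) v)}

/-- The pair of faces `(F, G)` belongs to `F^φ`: there are no `x ∈ F`, `y ∈ G`, `λ > 0` with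
`(π(x,y), φ(x,y) - λ) ∈ P^φ`. -/
def InFphi {n : ℕ} (P : Set (Vec n)) (v : Vec n) (F G : Set (Vec n)) : Prop :=
  ¬ ∃ x ∈ F, ∃ y ∈ G, ∃ lam : ℝ, 0 < lam ∧
      (Fin.snoc ((1 / 2 : ℝ) • (x + y)) (dot (x - y) v - lam) : Vec (n + 1)) ∈ Pphi P v

/-- The set `(A + B)/2`. -/
def avgSet {n : ℕ} (A B : Set (Vec n)) : Set (Vec n) :=
  {z | ∃ x ∈ A, ∃ y ∈ B, z = (1 / 2 : ℝ) • (x + y)}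

/-- The coherent subdivision `π(F^φ)` is tight. -/
def TightSub {n : ℕ} (P : Set (Vec n)) (v : Vec n) : Prop :=
  ∀ F G : Set (Vec n), IsFace P F → IsFace P G → F.Nonempty → G.Nonempty →
    InFphi P v F G → sdim F + sdim G = sdim (avgSet F G)

/-- `d` is a direction of an edge of `P ∩ ρ_z P` for some `z ∈ P`; the hyperplanes of the
fundamental hyperplane arrangement `H_P` are the orthogonal complements of such directions. -/
def EdgeDir {n : ℕ} (P : Set (Vec n)) (d : Vec n) : Prop :=
  d ≠ 0 ∧ ∃ z ∈ P, ∃ E, IsEdge (P ∩ reflP z P) E ∧ d ∈ (affineSpan ℝ E).direction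

/-- The cone `cone(-N_P(F) ∪ N_P(G))`. -/
def diagCone {n : ℕ} (P F G : Set (Vec n)) : Set (Vec n) :=
  coneOf ((Neg.neg '' normalCone P F) ∪ normalCone P G)


/-- The normal fan of `P` refines the normal fan of `Q`: every normal cone of `Q` is a union of
normal cones of `P`, and the unions of all the cones coincide. -/
def NormalFanRefines {n : ℕ} (P Q : Set (Vec n)) : Prop :=
  (∀ G : Set (Vec n), IsFace Q G → G.Nonempty →
      ∃ S : Set (Set (Vec n)),
        (∀ C ∈ S, ∃ F, IsFace P F ∧ F.Nonempty ∧ C = normalCone P F) ∧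
        normalCone Q G = ⋃₀ S) ∧
  (⋃ F ∈ {F : Set (Vec n) | IsFace P F ∧ F.Nonempty}, normalCone P F) =
    ⋃ G ∈ {G : Set (Vec n) | IsFace Q G ∧ G.Nonempty}, normalCone Q G

theorem dot_eq_dotProduct {n : ℕ} (x y : Vec n) : dot x y = x ⬝ᵥ y := rfl

theorem dot_add {n : ℕ} (c x y : Vec n) : dot c (x + y) = dot c x + dot c y := by
  simp [dot_eq_dotProduct]

theorem dot_sub {n : ℕ} (c x y : Vec n) : dot c (x - y) = dot c x - dot c y := by
  simp [dot_eq_dotProduct]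

theorem dot_smul {n : ℕ} (c : Vec n) (t : ℝ) (x : Vec n) : dot c (t • x) = t * dot c x := by
  simp [dot_eq_dotProduct]

theorem add_dot {n : ℕ} (c c' x : Vec n) : dot (c + c') x = dot c x + dot c' x := by
  simp [dot_eq_dotProduct]

theorem sub_dot {n : ℕ} (c c' x : Vec n) : dot (c - c') x = dot c x - dot c' x := by
  simp [dot_eq_dotProduct]

theorem smul_dot {n : ℕ} (t : ℝ) (c x : Vec n) : dot (t • c) x = t * dot c x := by
  simp [dot_eq_dotProduct]

/-- `dot c` as a linear functional. -/
def dotLin {n : ℕ} (c : Vec n) : Vec n →ₗ[ℝ] ℝ where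
  toFun := dot c
  map_add' := dot_add c
  map_smul' := fun t x => dot_smul c t x

@[simp] theorem dotLin_apply {n : ℕ} (c x : Vec n) : dotLin c x = dot c x := rfl

theorem exists_dot_eq {n : ℕ} (f : Vec n →ₗ[ℝ] ℝ) : ∃ c : Vec n, ∀ x, f x = dot c x := by
  refine ⟨fun i => f (Pi.single i 1), fun x => ?_⟩
  rw [LinearMap.pi_apply_eq_sum_univ f x]
  simp [dot, mul_comm, ← Pi.single_apply, Pi.single_comm]

/-- A vector orthogonal to everything orthogonal to a subspace `W` lies in `W`. -/
theorem mem_of_forall_dot_eq_zero {n : ℕ} {W : Submodule ℝ (Vec n)} {d : Vec n}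
    (h : ∀ c : Vec n, (∀ w ∈ W, dot c w = 0) → dot c d = 0) : d ∈ W := by
  by_contra hd
  obtain ⟨f, hfd, hf⟩ := Submodule.exists_le_ker_of_notMem hd
  obtain ⟨c, hc⟩ := exists_dot_eq f
  exact hfd ((hc d).trans (h c fun w hw => (hc w).symm.trans (hf hw)))

/-- The points of `P` where `dot c` attains its maximum over `P`. -/
def maximizers {n : ℕ} (P : Set (Vec n)) (c : Vec n) : Set (Vec n) :=
  {x ∈ P | ∀ y ∈ P, dot c y ≤ dot c x}

theorem dot_eq_of_mem_maximizers {n : ℕ} {P : Set (Vec n)} {c x y : Vec n}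
    (hx : x ∈ maximizers P c) (hy : y ∈ maximizers P c) : dot c x = dot c y :=
  le_antisymm (hy.2 x hx.1) (hx.2 y hy.1)

theorem mem_maximizers_of_dot_eq {n : ℕ} {P : Set (Vec n)} {c x y : Vec n}
    (hx : x ∈ maximizers P c) (hy : y ∈ P) (h : dot c y = dot c x) : y ∈ maximizers P c :=
  ⟨hy, fun z hz => h ▸ hx.2 z hz⟩

theorem IsPolytope.convex {n : ℕ} {P : Set (Vec n)} (hP : IsPolytope P) : Convex ℝ P := by
  obtain ⟨S, rfl⟩ := hP
  exact convex_convexHull ℝ _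

theorem maximizers_convexHull {n : ℕ} (S : Finset (Vec n)) (c : Vec n) :
    maximizers (convexHull ℝ (S : Set (Vec n))) c =
      convexHull ℝ {s | s ∈ S ∧ s ∈ maximizers (convexHull ℝ (S : Set (Vec n))) c} := by
  apply Set.Subset.antisymm
  · intro p hp
    obtain ⟨w, hw0, hw1, hwp⟩ := Finset.mem_convexHull'.1 hp.1
    have hle : ∀ s ∈ S, w s * dot c s ≤ w s * dot c p := fun s hs =>
      mul_le_mul_of_nonneg_left (hp.2 s (subset_convexHull ℝ _ hs)) (hw0 s hs)
    have hsum : ∑ s ∈ S, w s * dot c s = ∑ s ∈ S, w s * dot c p := by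
      rw [← Finset.sum_mul, hw1, one_mul]
      conv_rhs => rw [← hwp, ← dotLin_apply, map_sum]
      simp
    have heq := (Finset.sum_eq_sum_iff_of_le hle).1 hsum
    rw [← hwp, ← Finset.sum_filter_of_ne (p := fun s => w s ≠ 0)]
    · refine (convex_convexHull ℝ _).sum_mem (fun s hs => hw0 s (Finset.mem_filter.1 hs).1) ?_ ?_
      · rw [Finset.sum_filter_of_ne fun _ _ h => h, hw1]
      · intro s hs
        obtain ⟨hs, hs0⟩ := Finset.mem_filter.1 hs
        refine subset_convexHull ℝ _ ⟨hs, mem_maximizers_of_dot_eq hp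
          (subset_convexHull ℝ _ hs) (mul_left_cancel₀ hs0 (heq s hs))⟩
    · intro s _ h h0
      exact h (by rw [h0, zero_smul])
  · refine convexHull_min (fun s hs => hs.2) ?_
    intro x hx y hy a b ha hb hab
    have hxy := dot_eq_of_mem_maximizers hx hy
    refine mem_maximizers_of_dot_eq hx (convex_convexHull ℝ _ hx.1 hy.1 ha hb hab) ?_
    rw [dot_add, dot_smul, dot_smul, ← hxy, ← add_mul, hab, one_mul]

theorem IsPolytope.maximizers {n : ℕ} {P : Set (Vec n)} (hP : IsPolytope P) (c : Vec n) :
    IsPolytope (maximizers P c) := by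
  classical
  obtain ⟨S, rfl⟩ := hP
  refine ⟨S.filter (· ∈ _root_.maximizers (convexHull ℝ (S : Set (Vec n))) c), ?_⟩
  rw [Finset.coe_filter, ← maximizers_convexHull]

theorem IsPolytope.maximizers_nonempty {n : ℕ} {P : Set (Vec n)} (hP : IsPolytope P)
    (hne : P.Nonempty) (c : Vec n) : (_root_.maximizers P c).Nonempty := by
  obtain ⟨S, rfl⟩ := hP
  obtain ⟨s, hs, hmax⟩ := S.exists_max_image (dot c) (by simpa using hne)
  refine ⟨s, subset_convexHull ℝ _ hs, fun y hy => ?_⟩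
  exact convexHull_min (fun t ht => hmax t ht)
    (convex_halfSpace_le (dotLin c).isLinear (dot c s)) hy

/-- The directions along which one can move both ways from `x` inside the convex set `P`. -/
def feasibleDirs {n : ℕ} {P : Set (Vec n)} (hP : Convex ℝ P) {x : Vec n} (hx : x ∈ P) :
    Submodule ℝ (Vec n) where
  carrier := {d | ∃ ε : ℝ, 0 < ε ∧ x + ε • d ∈ P ∧ x - ε • d ∈ P}
  zero_mem' := ⟨1, one_pos, by simpa using hx, by simpa using hx⟩
  add_mem' := by
    rintro d e ⟨ε, hε, h1, h2⟩ ⟨δ, hδ, h3, h4⟩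
    have hs : 0 < ε + δ := by positivity
    have hab : δ / (ε + δ) + ε / (ε + δ) = 1 := by field_simp; ring
    refine ⟨ε * δ / (ε + δ), by positivity, ?_, ?_⟩
    · convert hP h1 h3 (by positivity : 0 ≤ δ / (ε + δ)) (by positivity : 0 ≤ ε / (ε + δ)) hab
        using 1
      linear_combination (norm := module) (-hab) • x
    · convert hP h2 h4 (by positivity : 0 ≤ δ / (ε + δ)) (by positivity : 0 ≤ ε / (ε + δ)) hab
        using 1
      linear_combination (norm := module) (-hab) • x
  smul_mem' := by
    rintro t d ⟨ε, hε, h1, h2⟩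
    rcases lt_trichotomy t 0 with ht | rfl | ht
    · refine ⟨ε / (-t), div_pos hε (neg_pos.2 ht), ?_, ?_⟩ <;>
        rw [smul_smul, div_mul_eq_mul_div, div_neg, mul_div_assoc, div_self ht.ne, mul_one, neg_smul]
      · rwa [← sub_eq_add_neg]
      · rwa [sub_neg_eq_add]
    · exact ⟨1, one_pos, by simpa using hx, by simpa using hx⟩
    · refine ⟨ε / t, by positivity, ?_, ?_⟩ <;> rwa [smul_smul, div_mul_cancel₀ _ ht.ne']

theorem mem_feasibleDirs {n : ℕ} {P : Set (Vec n)} {hP : Convex ℝ P} {x : Vec n} {hx : x ∈ P}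
    {d : Vec n} :
    d ∈ feasibleDirs hP hx ↔ ∃ ε : ℝ, 0 < ε ∧ x + ε • d ∈ P ∧ x - ε • d ∈ P := Iff.rfl

/-- A maximal linear functional vanishes on the feasible directions. -/
theorem dot_eq_zero_of_mem_feasibleDirs {n : ℕ} {P : Set (Vec n)} {hP : Convex ℝ P}
    {c x d : Vec n} {hxP : x ∈ P} (hx : x ∈ maximizers P c) (hd : d ∈ feasibleDirs hP hxP) :
    dot c d = 0 := by
  obtain ⟨ε, hε, h1, h2⟩ := hd
  have h1 := hx.2 _ h1
  have h2 := hx.2 _ h2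
  rw [dot_add, dot_smul] at h1
  rw [dot_sub, dot_smul] at h2
  exact (mul_eq_zero.1 (by linarith : ε * dot c d = 0)).resolve_left hε.ne'

theorem sub_mem_feasibleDirs_of_sum {n : ℕ} {P : Set (Vec n)} (hP : Convex ℝ P) {x : Vec n}
    (hx : x ∈ P) {ι : Type*} [Fintype ι] {a : ι → Vec n} (ha : ∀ i, a i ∈ P) {w : ι → ℝ}
    (hw : ∀ i, 0 < w i) (hw1 : ∑ i, w i = 1) (hwx : ∑ i, w i • a i = x) (i : ι) :
    a i - x ∈ feasibleDirs hP hx := by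
  classical
  have hi : w i ≤ 1 := hw1 ▸ Finset.single_le_sum (fun j _ => (hw j).le) (Finset.mem_univ i)
  refine ⟨w i, hw i, ?_, ?_⟩
  · exact hP.add_smul_sub_mem hx (ha i) ⟨(hw i).le, hi⟩
  · have : x - w i • (a i - x) = ∑ j, ((1 + w i) * w j - if j = i then w i else 0) • a j := by
      simp only [sub_smul, Finset.sum_sub_distrib, mul_smul, ← Finset.smul_sum, hwx, ite_smul,
        zero_smul, Finset.sum_ite_eq', Finset.mem_univ, if_true]
      module
    rw [this]
    refine hP.sum_mem (fun j _ => ?_) ?_ fun j _ => ha j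
    · split_ifs with h
      · subst h
        nlinarith [hw j]
      · nlinarith [mul_pos (hw i) (hw j), hw j]
    · simp [Finset.sum_sub_distrib, ← Finset.mul_sum, hw1]

/-- `x` lies in the relative interior of the face of `P` on which `dot c` is maximal. -/
def InRelintFace {n : ℕ} {P : Set (Vec n)} (hP : Convex ℝ P) (c x : Vec n) : Prop :=
  ∃ hx : x ∈ maximizers P c, ∀ p ∈ maximizers P c, p - x ∈ feasibleDirs hP hx.1

theorem inRelintFace_of_sum {n : ℕ} {P : Set (Vec n)} (hP : Convex ℝ P) {c x : Vec n}
    (hx : x ∈ maximizers P c) {ι : Type*} [Fintype ι] {a : ι → Vec n}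
    (ha : maximizers P c = convexHull ℝ (Set.range a)) {w : ι → ℝ} (hw : ∀ i, 0 < w i)
    (hwx : ∑ i, w i • (a i - x) = 0) : InRelintFace hP c x := by
  have hne : Nonempty ι := by
    have hx' := hx
    rw [ha] at hx'
    exact Set.range_nonempty_iff_nonempty.1 (convexHull_nonempty_iff.1 ⟨x, hx'⟩)
  have hpos : 0 < ∑ i, w i := Finset.sum_pos (fun i _ => hw i) Finset.univ_nonempty
  have haP : ∀ i, a i ∈ P := fun i =>
    (ha.ge (subset_convexHull ℝ _ (Set.mem_range_self i)) : a i ∈ maximizers P c).1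
  refine ⟨hx, fun p hp => ?_⟩
  have key : Set.range a ⊆ {p | p - x ∈ feasibleDirs hP hx.1} := by
    rintro _ ⟨i, rfl⟩
    refine sub_mem_feasibleDirs_of_sum hP hx.1 haP (w := fun i => w i / ∑ j, w j)
      (fun i => div_pos (hw i) hpos) (by rw [← Finset.sum_div, div_self hpos.ne']) ?_ i
    simp only [smul_sub, Finset.sum_sub_distrib, ← Finset.sum_smul] at hwx
    simp only [div_eq_inv_mul, mul_smul, ← Finset.smul_sum]
    rw [sub_eq_zero.1 hwx, smul_smul, inv_mul_cancel₀ hpos.ne', one_smul]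
  have hconv : Convex ℝ {p | p - x ∈ feasibleDirs hP hx.1} := by
    simp only [sub_eq_add_neg]
    exact (feasibleDirs hP hx.1).convex.translate_preimage_left (-x)
  exact convexHull_min key hconv (ha ▸ hp)

theorem IsPolytope.exists_eq_convexHull_range {n : ℕ} {P : Set (Vec n)} (hP : IsPolytope P) :
    ∃ T : Finset (Vec n), P = convexHull ℝ (Set.range ((↑) : T → Vec n)) := by
  obtain ⟨T, hT⟩ := hP
  exact ⟨T, by simpa using hT⟩

theorem IsPolytope.exists_inRelintFace {n : ℕ} {P : Set (Vec n)} (hP : IsPolytope P)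
    (hne : P.Nonempty) (c : Vec n) : ∃ x, InRelintFace hP.convex c x := by
  obtain ⟨T, hT⟩ := (hP.maximizers c).exists_eq_convexHull_range
  have hne' : Nonempty T := by
    rw [← Set.range_nonempty_iff_nonempty (f := ((↑) : T → Vec n)),
      ← convexHull_nonempty_iff (𝕜 := ℝ), ← hT]
    exact hP.maximizers_nonempty hne c
  have hcard : (Fintype.card T : ℝ) ≠ 0 := Nat.cast_ne_zero.2 Fintype.card_ne_zero
  refine ⟨∑ i : T, (Fintype.card T : ℝ)⁻¹ • (i : Vec n), inRelintFace_of_sum hP.convex ?_ hT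
    (w := fun _ => 1) (fun _ => one_pos) ?_⟩
  · rw [hT]
    exact (convex_convexHull ℝ _).sum_mem (fun _ _ => by positivity)
      (by simpa using mul_inv_cancel₀ hcard) fun i _ => subset_convexHull ℝ _ (Set.mem_range_self i)
  · simp only [one_smul, Finset.sum_sub_distrib, Finset.sum_const, Finset.card_univ,
      ← Nat.cast_smul_eq_nsmul ℝ]
    rw [← Finset.smul_sum, smul_smul, mul_inv_cancel₀ hcard, one_smul, sub_self]

/-- **Stiemke's lemma**. -/
theorem exists_pos_sum_smul_eq_zero_or {n : ℕ} {ι : Type*} [Fintype ι] (a : ι → Vec n) :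
    (∃ w : ι → ℝ, (∀ i, 0 < w i) ∧ ∑ i, w i • a i = 0) ∨
      ∃ c : Vec n, (∀ i, dot c (a i) ≤ 0) ∧ ∃ i, dot c (a i) < 0 := by
  classical
  rw [or_iff_not_imp_left]
  intro hno
  let A : (ι → ℝ) →ₗ[ℝ] Vec n := Fintype.linearCombination ℝ a
  have hA : ∀ w, A w = ∑ i, w i • a i := fun w => Fintype.linearCombination_apply ℝ a w
  have hopen : IsOpen (Set.univ.pi fun _ : ι => Set.Ioi (0 : ℝ)) :=
    isOpen_set_pi Set.finite_univ fun _ _ => isOpen_Ioi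
  have hconv : Convex ℝ (Set.univ.pi fun _ : ι => Set.Ioi (0 : ℝ)) :=
    convex_pi fun _ _ => convex_Ioi 0
  have hdisj : Disjoint (Set.univ.pi fun _ : ι => Set.Ioi (0 : ℝ))
      (LinearMap.ker A : Set (ι → ℝ)) := by
    rw [Set.disjoint_left]
    intro w hw hw'
    exact hno ⟨w, fun i => hw i trivial, (hA w).symm.trans hw'⟩
  obtain ⟨f, u, hfu, hu⟩ := geometric_hahn_banach_open hconv hopen (LinearMap.ker A).convex hdisj
  have hu0 : u ≤ 0 := by simpa using hu 0 (zero_mem _)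
  have hker : ∀ w ∈ LinearMap.ker A, f w = 0 := by
    intro w hw
    by_contra hne
    have := hu (((u - 1) / f w) • w) ((LinearMap.ker A).smul_mem _ hw)
    rw [map_smul, smul_eq_mul, div_mul_cancel₀ _ hne] at this
    linarith
  have hf : (f : (ι → ℝ) →ₗ[ℝ] ℝ) ∈ LinearMap.range A.dualMap := by
    rw [LinearMap.range_dualMap_eq_dualAnnihilator_ker, Submodule.mem_dualAnnihilator]
    exact hker
  obtain ⟨g, hg⟩ := hf
  obtain ⟨c, hc⟩ := exists_dot_eq g
  have hcA : ∀ w, dot c (A w) = f w := fun w => by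
    rw [← hc]
    exact LinearMap.congr_fun hg w
  have hca : ∀ i, dot c (a i) = f (Pi.single i 1) := fun i => by
    rw [← hcA, hA]
    simp [Pi.single_apply]
  have hneg : ∀ w : ι → ℝ, (∀ i, 0 < w i) → f w < 0 := fun w hw =>
    (hfu w fun i _ => hw i).trans_le hu0
  have h1 : f 1 < 0 := hneg 1 fun _ => one_pos
  refine ⟨c, fun i => ?_, ?_⟩
  · rw [hca]
    by_contra! hpos
    have := hneg (Pi.single i 1 + (f (Pi.single i 1) / (-f 1)) • 1) fun j => by
      have h2 : 0 < f (Pi.single i 1) / (-f 1) := div_pos hpos (neg_pos.2 h1)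
      have h3 : (0 : ℝ) ≤ (Pi.single i 1 : ι → ℝ) j := by
        rw [Pi.single_apply]
        split_ifs <;> norm_num
      simpa using add_pos_of_nonneg_of_pos h3 h2
    rw [map_add, map_smul, smul_eq_mul, div_neg, neg_mul, div_mul_cancel₀ _ h1.ne] at this
    linarith
  · by_contra! hge
    have : f 1 = ∑ i, f (Pi.single i 1) := by
      rw [← map_sum]
      congr 1
      exact (Finset.univ_sum_single (1 : ι → ℝ)).symm
    rw [this] at h1
    exact h1.not_ge (Finset.sum_nonneg fun i _ => (hca i) ▸ hge i)

open Filter Topology in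
theorem IsPolytope.eventually_smul_dot_sub_le {n : ℕ} {P : Set (Vec n)} (hP : IsPolytope P)
    {c c' x : Vec n} (hx : x ∈ _root_.maximizers P c)
    (hc' : ∀ p ∈ _root_.maximizers P c, dot c' p ≤ dot c' x) :
    ∀ᶠ ε : ℝ in 𝓝[>] 0, ∀ p ∈ P, ε * dot c' (p - x) ≤ dot c (x - p) := by
  obtain ⟨S, rfl⟩ := hP
  have hS : ∀ᶠ ε : ℝ in 𝓝[>] 0, ∀ s ∈ S, ε * dot c' (s - x) ≤ dot c (x - s) := by
    rw [eventually_all_finset]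
    intro s hs
    have hsP := subset_convexHull ℝ (S : Set (Vec n)) hs
    rcases (hx.2 s hsP).eq_or_lt with h | h
    · filter_upwards [self_mem_nhdsWithin] with ε hε
      have := hc' s (mem_maximizers_of_dot_eq hx hsP h)
      rw [dot_sub, dot_sub, h, sub_self]
      exact mul_nonpos_of_nonneg_of_nonpos (le_of_lt hε) (by linarith)
    · have ht : Tendsto (fun ε : ℝ => ε * dot c' (s - x)) (𝓝[>] 0) (𝓝 0) := by
        have : Continuous fun ε : ℝ => ε * dot c' (s - x) := by fun_prop
        simpa using (this.tendsto 0).mono_left nhdsWithin_le_nhds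
      have hpos : 0 < dot c (x - s) := by rw [dot_sub]; linarith
      filter_upwards [ht.eventually_lt_const hpos] with ε hε using hε.le
  filter_upwards [hS] with ε hε p hp
  have key : dot (ε • c' + c) p ≤ dot (ε • c' + c) x := by
    refine convexHull_min (fun s hs => ?_)
      (convex_halfSpace_le (dotLin (ε • c' + c)).isLinear (dot (ε • c' + c) x)) hp
    have := hε s hs
    simp only [dot_sub] at this
    simp only [Set.mem_ofPred_eq, dotLin_apply, add_dot, smul_dot]
    linarith
  simp only [add_dot, smul_dot] at key
  simp only [dot_sub]
  linarith

open Filter Topology in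
/-- Small perturbations of a functional in a direction `c'` cut out the part of its face on which
`c'` is maximal. -/
theorem IsPolytope.eventually_mem_maximizers_add {n : ℕ} {P : Set (Vec n)} (hP : IsPolytope P)
    {c c' x : Vec n} (hx : x ∈ _root_.maximizers P c)
    (hc' : ∀ p ∈ _root_.maximizers P c, dot c' p ≤ dot c' x) :
    ∀ᶠ ε : ℝ in 𝓝[>] 0, x ∈ _root_.maximizers P (c + ε • c') ∧
      ∀ p ∈ _root_.maximizers P (c + ε • c'),
        p ∈ _root_.maximizers P c ∧ dot c' p = dot c' x := by
  have h2 : ∀ p ∈ _root_.maximizers P c, dot ((2 : ℝ) • c') p ≤ dot ((2 : ℝ) • c') x := by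
    intro p hp
    simpa only [smul_dot, mul_le_mul_iff_right₀ (two_pos : (0 : ℝ) < 2)] using hc' p hp
  filter_upwards [hP.eventually_smul_dot_sub_le hx h2, self_mem_nhdsWithin] with ε hε hpos
  simp only [smul_dot, dot_sub] at hε
  have hmax : x ∈ _root_.maximizers P (c + ε • c') := by
    refine ⟨hx.1, fun p hp => ?_⟩
    have h1 := hε p hp
    have h3 := hx.2 p hp
    simp only [add_dot, smul_dot]
    linarith
  refine ⟨hmax, fun p hp => ?_⟩
  have h1 := hε p hp.1
  have h3 := hx.2 p hp.1
  have h4 := dot_eq_of_mem_maximizers hmax hp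
  simp only [add_dot, smul_dot] at h4
  refine ⟨mem_maximizers_of_dot_eq hx hp.1 (by linarith), ?_⟩
  exact mul_left_cancel₀ (ne_of_gt hpos) (by linarith)

open Filter Topology in
/-- If `c` minimizes the dimension of its face of `P` over a family of functionals that contains
small perturbations of `c` in the direction `c'`, then `c'` is constant on the face. -/
theorem IsPolytope.dot_eq_of_minimal {n : ℕ} {P : Set (Vec n)} (hP : IsPolytope P)
    (hne : P.Nonempty) {C : Vec n → Prop} {c c' : Vec n}
    (hmin : MinimalFor C (fun c => Module.finrank ℝ (vectorSpan ℝ (_root_.maximizers P c))) c)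
    (hC : ∀ᶠ ε : ℝ in 𝓝[>] 0, C (c + ε • c')) {p q : Vec n}
    (hp : p ∈ _root_.maximizers P c) (hq : q ∈ _root_.maximizers P c) : dot c' p = dot c' q := by
  obtain ⟨y, hy, hymax⟩ := (hP.maximizers c).maximizers_nonempty (hP.maximizers_nonempty hne c) c'
  obtain ⟨ε, hε, -, hface⟩ := (hC.and (hP.eventually_mem_maximizers_add hy hymax)).exists
  have hle : vectorSpan ℝ (_root_.maximizers P (c + ε • c')) ≤
      vectorSpan ℝ (_root_.maximizers P c) := vectorSpan_mono ℝ fun p hp => (hface p hp).1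
  have heq := Submodule.eq_of_le_of_finrank_le hle
    (hmin.2 hε (Submodule.finrank_mono hle))
  have hker : vectorSpan ℝ (_root_.maximizers P (c + ε • c')) ≤ LinearMap.ker (dotLin c') := by
    rw [vectorSpan_def, Submodule.span_le]
    rintro _ ⟨a, ha, b, hb, rfl⟩
    simp [dot_sub, (hface a ha).2, (hface b hb).2]
  have := hker (heq.ge (vsub_mem_vectorSpan ℝ hp hq))
  simpa [dot_sub, sub_eq_zero] using this

theorem IsPolytope.exists_inRelintFace_of_mem {n : ℕ} {P : Set (Vec n)} (hP : IsPolytope P)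
    {x : Vec n} (hx : x ∈ P) : ∃ c, InRelintFace hP.convex c x := by
  obtain ⟨c, hc⟩ := exists_minimalFor_of_wellFoundedLT (fun c => x ∈ _root_.maximizers P c)
    (fun c => Module.finrank ℝ (vectorSpan ℝ (_root_.maximizers P c)))
    ⟨0, hx, by simp [dot]⟩
  have hxc : x ∈ _root_.maximizers P c := hc.1
  refine ⟨c, ?_⟩
  obtain ⟨T, hT⟩ := (hP.maximizers c).exists_eq_convexHull_range
  have hTP : ∀ i : T, (i : Vec n) ∈ _root_.maximizers P c := fun i =>
    hT.ge (subset_convexHull ℝ _ (Set.mem_range_self i))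
  rcases exists_pos_sum_smul_eq_zero_or fun i : T => (i : Vec n) - x with
    ⟨w, hw, hsum⟩ | ⟨c', hle, i, hi⟩
  · exact inRelintFace_of_sum hP.convex hxc hT hw hsum
  · have hmax : ∀ p ∈ _root_.maximizers P c, dot c' p ≤ dot c' x := by
      intro p hp
      refine convexHull_min ?_ (convex_halfSpace_le (dotLin c').isLinear (dot c' x)) (hT ▸ hp)
      rintro _ ⟨j, rfl⟩
      have := hle j
      rw [dot_sub] at this
      exact sub_nonpos.1 this
    have := hP.dot_eq_of_minimal ⟨x, hx⟩ hc
      ((hP.eventually_mem_maximizers_add hxc hmax).mono fun ε h => h.1) (hTP i) hxc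
    rw [dot_sub, this, sub_self] at hi
    exact absurd hi (lt_irrefl 0)

open Filter Topology in
theorem InRelintFace.eventually_add {n : ℕ} {P : Set (Vec n)} (hP : IsPolytope P) {c c' x : Vec n}
    (h : InRelintFace hP.convex c x) (hc' : ∀ d ∈ feasibleDirs hP.convex h.1.1, dot c' d = 0) :
    ∀ᶠ ε : ℝ in 𝓝[>] 0, InRelintFace hP.convex (c + ε • c') x := by
  have hle : ∀ p ∈ maximizers P c, dot c' p ≤ dot c' x := fun p hp => by
    have := hc' _ (h.2 p hp)
    rw [dot_sub] at this
    exact (sub_eq_zero.1 this).le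
  filter_upwards [hP.eventually_mem_maximizers_add h.1 hle] with ε hε
  exact ⟨hε.1, fun p hp => h.2 p (hε.2 p hp).1⟩

open Filter Topology in
/-- If `x ∈ Q` and the normal fan of `P` refines that of `Q`, then some point of `P` has the same
feasible directions as `x`. -/
theorem exists_feasibleDirs_eq {n : ℕ} {P Q : Set (Vec n)} (hP : IsPolytope P) (hQ : IsPolytope Q)
    (href : NormalFanRefines P Q) (hne : P.Nonempty) {x : Vec n} (hx : x ∈ Q) :
    ∃ c x', ∃ h : InRelintFace hP.convex c x',
      feasibleDirs hP.convex h.1.1 = feasibleDirs hQ.convex hx := by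
  obtain ⟨c, hc⟩ := exists_minimalFor_of_wellFoundedLT (fun c => InRelintFace hQ.convex c x)
    (fun c => Module.finrank ℝ (vectorSpan ℝ (maximizers P c)))
    (hQ.exists_inRelintFace_of_mem hx)
  have hxc : InRelintFace hQ.convex c x := hc.1
  obtain ⟨x', hx'⟩ := hP.exists_inRelintFace hne c
  refine ⟨c, x', hx', le_antisymm (fun d hd => ?_) fun d hd => ?_⟩
  · refine mem_of_forall_dot_eq_zero fun c' hc' => ?_
    obtain ⟨ε, hε, h1, -⟩ := mem_feasibleDirs.1 hd
    have hcd : dot c d = 0 := dot_eq_zero_of_mem_feasibleDirs hx'.1 hd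
    have hface : x' + ε • d ∈ maximizers P c :=
      mem_maximizers_of_dot_eq hx'.1 h1 (by rw [dot_add, dot_smul, hcd, mul_zero, add_zero])
    have := hP.dot_eq_of_minimal hne hc (hxc.eventually_add hQ hc') hface hx'.1
    rw [dot_add, dot_smul, add_eq_left, mul_eq_zero] at this
    exact this.resolve_left hε.ne'
  · refine mem_of_forall_dot_eq_zero fun c' hc' => ?_
    obtain ⟨S, hS, hSeq⟩ := href.1 (maximizers Q c) ⟨c, rfl⟩ ⟨x, hxc.1⟩
    have hcS : c ∈ ⋃₀ S := hSeq ▸ (fun _ hy => hy : c ∈ normalCone Q (maximizers Q c))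
    obtain ⟨N, hN, hcN⟩ := hcS
    obtain ⟨F, -, -, rfl⟩ := hS N hN
    obtain ⟨ε, hε, hpos⟩ :=
      ((hx'.eventually_add hP hc').and self_mem_nhdsWithin).exists
    have hmem : c + ε • c' ∈ normalCone P F := by
      intro p hp
      have hpc : p ∈ maximizers P c := hcN hp
      have hpd := hc' _ (hx'.2 p hpc)
      rw [dot_sub, sub_eq_zero] at hpd
      refine mem_maximizers_of_dot_eq hε.1 hpc.1 ?_
      rw [add_dot, smul_dot, add_dot, smul_dot, hpd, dot_eq_of_mem_maximizers hpc hx'.1]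
    have hmemQ : c + ε • c' ∈ normalCone Q (maximizers Q c) := hSeq ▸ ⟨_, hN, hmem⟩
    have h1 := dot_eq_zero_of_mem_feasibleDirs (hmemQ hxc.1) hd
    rw [add_dot, smul_dot, dot_eq_zero_of_mem_feasibleDirs hxc.1 hd, zero_add, mul_eq_zero] at h1
    exact h1.resolve_left (ne_of_gt hpos)

theorem mem_reflP {n : ℕ} {z p : Vec n} {P : Set (Vec n)} :
    p ∈ reflP z P ↔ (2 : ℝ) • z - p ∈ P := by
  constructor
  · rintro ⟨q, hq, rfl⟩
    simpa using hq
  · intro h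
    exact ⟨_, h, by simp⟩

theorem exists_common_step_of_mem_feasibleDirs {n : ℕ} {P : Set (Vec n)} {hP : Convex ℝ P}
    {x y : Vec n} {hx : x ∈ P} {hy : y ∈ P} {d : Vec n} (h1 : d ∈ feasibleDirs hP hx)
    (h2 : d ∈ feasibleDirs hP hy) :
    ∃ ε : ℝ, 0 < ε ∧ (x + ε • d ∈ P ∧ x - ε • d ∈ P) ∧ y + ε • d ∈ P ∧ y - ε • d ∈ P := by
  have shrink : ∀ {x d : Vec n} {ε δ : ℝ}, x ∈ P → 0 < δ → δ ≤ ε → x + ε • d ∈ P →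
      x + δ • d ∈ P := by
    intro x d ε δ hx hδ hle h
    have hε := hδ.trans_le hle
    have := hP.add_smul_mem hx h (t := δ / ε) ⟨by positivity, (div_le_one hε).2 hle⟩
    rwa [smul_smul, div_mul_cancel₀ _ hε.ne'] at this
  obtain ⟨ε, hε, ha, hb⟩ := h1
  obtain ⟨δ, hδ, ka, kb⟩ := h2
  rw [sub_eq_add_neg, ← smul_neg] at hb kb
  have hm : 0 < min ε δ := lt_min hε hδ
  refine ⟨min ε δ, hm, ⟨shrink hx hm (min_le_left _ _) ha, ?_⟩,
    shrink hy hm (min_le_right _ _) ka, ?_⟩ <;> rw [sub_eq_add_neg, ← smul_neg]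
  · exact shrink hx hm (min_le_left _ _) hb
  · exact shrink hy hm (min_le_right _ _) kb

/-- The direction of an edge of `P ∩ ρ_z P` is the space of common feasible directions of two
points of `P`. -/
theorem exists_feasibleDirs_inf_eq_of_isEdge {n : ℕ} {P : Set (Vec n)} (hP : Convex ℝ P)
    {z : Vec n} {E : Set (Vec n)} (hE : IsEdge (P ∩ reflP z P) E) :
    ∃ x y, ∃ (hx : x ∈ P) (hy : y ∈ P),
      feasibleDirs hP hx ⊓ feasibleDirs hP hy = (affineSpan ℝ E).direction := by
  obtain ⟨⟨c, hEc⟩, hdim⟩ := hE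
  change E = maximizers (P ∩ reflP z P) c at hEc
  rw [sdim] at hdim
  rw [direction_affineSpan] at hdim ⊢
  have hsub : ¬ E.Subsingleton := fun h => by
    rw [vectorSpan_of_subsingleton ℝ h, finrank_bot] at hdim
    exact zero_ne_one hdim
  obtain ⟨a, ha, b, hb, hab⟩ := Set.not_subsingleton_iff.1 hsub
  have ha' := ha
  have hb' := hb
  rw [hEc] at ha' hb'
  have hab_mem : b - a ∈ vectorSpan ℝ E := vsub_mem_vectorSpan ℝ hb ha
  have hPab : a ∈ P ∧ b ∈ P := ⟨ha'.1.1, hb'.1.1⟩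
  have hPab' := And.intro (mem_reflP.1 ha'.1.2) (mem_reflP.1 hb'.1.2)
  have hhalf : (0 : ℝ) ≤ 1 / 2 := by norm_num
  have hone : (1 / 2 : ℝ) + 1 / 2 = 1 := by norm_num
  set x : Vec n := (1 / 2 : ℝ) • a + (1 / 2 : ℝ) • b with hxdef
  have hx : x ∈ P := hP hPab.1 hPab.2 hhalf hhalf hone
  have hy : (2 : ℝ) • z - x ∈ P := by
    convert hP hPab'.1 hPab'.2 hhalf hhalf hone using 1
    rw [hxdef]
    module
  have hxc : x ∈ maximizers (P ∩ reflP z P) c := by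
    refine mem_maximizers_of_dot_eq ha' ⟨hx, mem_reflP.2 hy⟩ ?_
    rw [hxdef, dot_add, dot_smul, dot_smul, dot_eq_of_mem_maximizers hb' ha']
    ring
  refine ⟨x, _, hx, hy, le_antisymm ?_ ?_⟩
  · rintro e ⟨h1, h2⟩
    obtain ⟨ε, hε, ⟨h3, h4⟩, h5, h6⟩ := exists_common_step_of_mem_feasibleDirs h1 h2
    have h7 : x + ε • e ∈ P ∩ reflP z P := ⟨h3, mem_reflP.2 (by rwa [← sub_sub])⟩
    have h8 : x - ε • e ∈ P ∩ reflP z P :=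
      ⟨h4, mem_reflP.2 (by rwa [sub_sub_eq_add_sub, add_sub_right_comm])⟩
    have h9 := hxc.2 _ h7
    have h10 := hxc.2 _ h8
    rw [dot_add] at h9
    rw [dot_sub] at h10
    have h11 : x + ε • e ∈ E := by
      rw [hEc]
      exact mem_maximizers_of_dot_eq hxc h7 (by rw [dot_add]; linarith)
    have h12 := vsub_mem_vectorSpan ℝ h11 (hEc ▸ hxc : x ∈ E)
    rw [vsub_eq_sub, add_sub_cancel_left] at h12
    exact ((vectorSpan ℝ E).smul_mem_iff hε.ne').1 h12
  · have hne : (⟨b - a, hab_mem⟩ : vectorSpan ℝ E) ≠ 0 := fun h =>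
      hab (sub_eq_zero.1 (congrArg Subtype.val h)).symm
    intro e he
    obtain ⟨t, ht⟩ := (finrank_eq_one_iff_of_nonzero' _ hne).1 hdim ⟨e, he⟩
    have ht' : t • (b - a) = e := congrArg Subtype.val ht
    rw [← ht']
    refine Submodule.smul_mem _ t ⟨⟨1 / 2, by norm_num, ?_, ?_⟩, ⟨1 / 2, by norm_num, ?_, ?_⟩⟩
    · convert hPab.2 using 1
      rw [hxdef]
      module
    · convert hPab.1 using 1
      rw [hxdef]
      module
    · convert hPab'.1 using 1
      rw [hxdef]
      module
    · convert hPab'.2 using 1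
      rw [hxdef]
      module

/-- If the common feasible directions of two points of `P` form a line, then this line is the
direction of an edge of some `P ∩ ρ_z P`. -/
theorem exists_isEdge_of_feasibleDirs_inf {n : ℕ} {P : Set (Vec n)} (hP : Convex ℝ P)
    {c₁ c₂ x y : Vec n} (hx : InRelintFace hP c₁ x) (hy : InRelintFace hP c₂ y)
    (hdim : Module.finrank ℝ ↥(feasibleDirs hP hx.1.1 ⊓ feasibleDirs hP hy.1.1) = 1) :
    ∃ z ∈ P, ∃ E, IsEdge (P ∩ reflP z P) E ∧
      (affineSpan ℝ E).direction = feasibleDirs hP hx.1.1 ⊓ feasibleDirs hP hy.1.1 := by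
  set z : Vec n := (1 / 2 : ℝ) • x + (1 / 2 : ℝ) • y with hz
  have hzP : z ∈ P := hP hx.1.1 hy.1.1 (by norm_num) (by norm_num) (by norm_num)
  have hzy : (2 : ℝ) • z - x = y := by
    rw [hz]
    module
  have hzz : ∀ r, (2 : ℝ) • z - r = x + y - r := fun r => by
    rw [hz]
    module
  have hxR : x ∈ maximizers (P ∩ reflP z P) (c₁ - c₂) := by
    refine ⟨⟨hx.1.1, mem_reflP.2 (hzy ▸ hy.1.1)⟩, fun r hr => ?_⟩
    have h1 := hx.1.2 r hr.1
    have h2 := hy.1.2 _ (mem_reflP.1 hr.2)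
    rw [hzz, dot_sub, dot_add] at h2
    rw [sub_dot, sub_dot]
    linarith
  have hdir : (affineSpan ℝ (maximizers (P ∩ reflP z P) (c₁ - c₂))).direction =
      feasibleDirs hP hx.1.1 ⊓ feasibleDirs hP hy.1.1 := by
    rw [direction_affineSpan]
    apply le_antisymm
    · rw [vectorSpan_eq_span_vsub_set_right ℝ hxR, Submodule.span_le]
      rintro _ ⟨r, hr, rfl⟩
      have h1 := hx.1.2 r hr.1.1
      have h2 := hy.1.2 _ (mem_reflP.1 hr.1.2)
      have h3 := dot_eq_of_mem_maximizers hr hxR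
      rw [hzz, dot_sub, dot_add] at h2
      rw [sub_dot, sub_dot] at h3
      refine ⟨hx.2 r (mem_maximizers_of_dot_eq hx.1 hr.1.1 (by linarith)), ?_⟩
      have h4 := hy.2 _ (mem_maximizers_of_dot_eq hy.1 (mem_reflP.1 hr.1.2)
        (by rw [hzz, dot_sub, dot_add]; linarith))
      rw [← Submodule.neg_mem_iff, hzz] at h4
      rw [(by abel : -(x + y - r - y) = r - x)] at h4
      exact h4
    · rintro d ⟨h1, h2⟩
      obtain ⟨ε, hε, ⟨h3, h4⟩, h5, h6⟩ := exists_common_step_of_mem_feasibleDirs h1 h2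
      have h7 : x + ε • d ∈ maximizers (P ∩ reflP z P) (c₁ - c₂) := by
        refine mem_maximizers_of_dot_eq hxR ⟨h3, mem_reflP.2 (by rwa [← sub_sub, hzy])⟩ ?_
        rw [dot_add, dot_smul, sub_dot _ _ d, dot_eq_zero_of_mem_feasibleDirs hx.1 h1,
          dot_eq_zero_of_mem_feasibleDirs hy.1 h2, sub_self, mul_zero, add_zero]
      have h8 := vsub_mem_vectorSpan ℝ h7 hxR
      rw [vsub_eq_sub, add_sub_cancel_left] at h8
      exact (Submodule.smul_mem_iff _ hε.ne').1 h8
  exact ⟨z, hzP, maximizers (P ∩ reflP z P) (c₁ - c₂),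
    ⟨⟨c₁ - c₂, rfl⟩, by rw [sdim, hdir, hdim]⟩, hdir⟩

theorem NormalFanRefines.nonempty {n : ℕ} {P Q : Set (Vec n)} (href : NormalFanRefines P Q)
    (hne : Q.Nonempty) : P.Nonempty := by
  have h0 : (0 : Vec n) ∈ ⋃ G ∈ {G : Set (Vec n) | IsFace Q G ∧ G.Nonempty}, normalCone Q G := by
    have hQ : Q = {x ∈ Q | ∀ y ∈ Q, dot 0 y ≤ dot 0 x} := by simp [dot]
    exact Set.mem_biUnion (⟨⟨0, hQ⟩, hne⟩ : Q ∈ {G | IsFace Q G ∧ G.Nonempty}) hQ.subset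
  rw [← href.2] at h0
  obtain ⟨F, ⟨⟨c, rfl⟩, x, hx⟩, -⟩ := Set.mem_iUnion₂.1 h0
  exact ⟨x, hx.1⟩

theorem EdgeDir.of_normalFanRefines {n : ℕ} {P Q : Set (Vec n)} (hP : IsPolytope P)
    (hQ : IsPolytope Q) (href : NormalFanRefines P Q) {d : Vec n} (hd : EdgeDir Q d) :
    EdgeDir P d := by
  obtain ⟨hd0, z, hz, E, hE, hdE⟩ := hd
  have hne := href.nonempty ⟨z, hz⟩
  obtain ⟨x, y, hx, hy, hxy⟩ := exists_feasibleDirs_inf_eq_of_isEdge hQ.convex hE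
  obtain ⟨c₁, x', hx', hxx'⟩ := exists_feasibleDirs_eq hP hQ href hne hx
  obtain ⟨c₂, y', hy', hyy'⟩ := exists_feasibleDirs_eq hP hQ href hne hy
  rw [← hxx', ← hyy'] at hxy
  obtain ⟨z', hz', E', hE', hdir⟩ :=
    exists_isEdge_of_feasibleDirs_inf hP.convex hx' hy' (hxy ▸ hE.2)
  exact ⟨hd0, z', hz', E', hE', hdir ▸ hxy ▸ hdE⟩

/-- If the normal fan of `P` refines the normal fan of `Q`, then the
fundamental hyperplane arrangements satisfy `H_Q ⊆ H_P` (every edge direction of a `Q ∩ ρ_z Q`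
is an edge direction of some `P ∩ ρ_w P`); consequently, if `(P, v)` is positively oriented
then so is `(Q, v)`. -/
theorem stmt10 {n : ℕ} (P Q : Set (Vec n))
    (hP : IsPolytope P) (hQ : IsPolytope Q) (href : NormalFanRefines P Q) :
    (∀ d : Vec n, EdgeDir Q d → EdgeDir P d) ∧
    (∀ v : Vec n, PosOriented P v → PosOriented Q v) := by
  have hdir : ∀ d : Vec n, EdgeDir Q d → EdgeDir P d := fun d hd =>
    hd.of_normalFanRefines hP hQ href
  refine ⟨hdir, fun v hv z hz E hE d hd hd0 => ?_⟩
  obtain ⟨-, w, hw, F, hF, hdF⟩ := hdir d ⟨hd0, z, hz, E, hE, hd⟩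
  exact hv w hw F hF d hdF hd0
end
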